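/- arXiv:1601.06456 — 2 statements merged into one kernel-verified Lean document; each statement's English description precedes it below -/
import Mathlib

section
/- For A = {0,1}, any n ≥ 3 and any k ∈ {2,3,…,n-1}, there exists a linear universal partial word for A^n with a single ◊ at position k beginning with 0 1^{k-2} ◊ c(0 1^{k-1}, n), where c(w, n) is obtained by repeating w periodically, truncating at length n, and complementing the last symbol. -/
/-- A partial-word symbol over the alphabet `Fin α`: `none` is the wildcard `◊`. -/
abbrev PSym (α : ℕ) := Option (Fin α)

/-- The word `v ∈ A^*` appears as a factor of the partial word `u` at 0-based position `i`:
each symbol of `u` in the window is either `◊` or equals the corresponding letter of `v`. -/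
def MatchAt {α : ℕ} (u : List (PSym α)) (v : List (Fin α)) (i : ℕ) : Prop :=
  i + v.length ≤ u.length ∧
    ∀ j < v.length, u[i + j]? = some none ∨ u[i + j]? = (v[j]?).map some

/-- `u` is a linear universal partial word (upword) for `A^n`, `A = Fin α`:
every word of length `n` over `A` appears exactly once as a factor. -/
def IsLinearUpword (α n : ℕ) (u : List (PSym α)) : Prop :=
  ∀ v : List (Fin α), v.length = n → ∃! i : ℕ, MatchAt u v i

/-- `v` appears as a cyclic factor of the partial word `u` at position `i`
(indices taken modulo `u.length`). -/
def CycMatchAt {α : ℕ} (u : List (PSym α)) (v : List (Fin α)) (i : ℕ) : Prop :=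
  ∀ j < v.length,
    u[(i + j) % u.length]? = some none ∨ u[(i + j) % u.length]? = (v[j]?).map some

/-- `u` is a cyclic universal partial word for `A^n`: every word of length `n` over `A`
appears exactly once as a cyclic factor. -/
def IsCyclicUpword (α n : ℕ) (u : List (PSym α)) : Prop :=
  ∀ v : List (Fin α), v.length = n → ∃! i : ℕ, i < u.length ∧ CycMatchAt u v i

/-- `cword w n` (the word `c(w,n)` of the paper): repeat `w` periodically, truncate at
length `n`, and complement the last symbol. (Here `cᵢ = w_{i mod |w|}` for `i < n-1`, 0-based,
and the last letter is the complement of `c_{n-1-|w|}`, which by periodicity equals the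
complement of `w_{(n-1) mod |w|}`.) -/
def cword (w : List (Fin 2)) (n : ℕ) : List (Fin 2) :=
  (List.range n).map fun i =>
    if i < n - 1 then w.getD (i % w.length) 0 else 1 - w.getD ((n - 1) % w.length) 0

/-- The window of length `m` of the sequence `f` starting at `i`. -/
def win {A : Type} (m : ℕ) (f : ℕ → A) (i : ℕ) : Fin m → A := fun j => f (i + j)

/-- All letters but the last. -/
def frontPart {A : Type} {m : ℕ} (x : Fin (m+1) → A) : Fin m → A := fun j => x j.castSucc

theorem frontPart_snoc {A : Type} {m : ℕ} (v : Fin m → A) (a : A) :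
    frontPart (Fin.snoc v a : Fin (m+1) → A) = v := by
  funext j; simp [frontPart]

theorem win_front {A : Type} (m : ℕ) (f : ℕ → A) (i : ℕ) :
    frontPart (win (m+1) f i) = win m f i := by
  funext j; simp [frontPart, win]

theorem win_tail {A : Type} (m : ℕ) (f : ℕ → A) (i : ℕ) :
    Fin.tail (win (m+1) f i) = win m f (i+1) := by
  funext j; simp [Fin.tail, win]; congr 1; omega

theorem win_eq_iff {A : Type} {m : ℕ} {f g : ℕ → A} {i j : ℕ} :
    win m f i = win m g j ↔ ∀ t < m, f (i + t) = g (j + t) := by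
  constructor
  · intro h t ht
    exact congrFun h ⟨t, ht⟩
  · intro h; funext t; exact h t t.2

/-- Balance of entries and exits. -/
theorem balance {A : Type} [Fintype A] [DecidableEq A] (m : ℕ) (f : ℕ → A) (N : ℕ)
    (v : Fin m → A) :
    ((Finset.range N).filter (fun i => win m f (i+1) = v)).card + (if win m f 0 = v then 1 else 0)
    = ((Finset.range N).filter (fun i => win m f i = v)).card
      + (if win m f N = v then 1 else 0) := by
  rw [Finset.card_filter, Finset.card_filter, ← Finset.sum_range_succ (fun i => if win m f i = v then 1 else 0),
    ← Finset.sum_range_succ' (fun i => if win m f i = v then 1 else 0)]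

theorem out_card {A : Type} [Fintype A] [DecidableEq A] (m : ℕ) (f : ℕ → A) (N : ℕ)
    (v : Fin m → A) (h : ∀ x : Fin (m+1) → A, frontPart x = v → ∃ i < N, win (m+1) f i = x) :
    Fintype.card A ≤ ((Finset.range N).filter (fun i => win m f i = v)).card := by
  rw [← Finset.card_univ]
  apply Finset.card_le_card_of_surjOn (fun i => f (i + m))
  intro a _
  obtain ⟨i, hi, hx⟩ := h (Fin.snoc v a) (frontPart_snoc v a)
  refine ⟨i, ?_, ?_⟩
  · simp only [Finset.coe_filter, Finset.mem_range, Set.mem_ofPred_eq]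
    exact ⟨hi, by rw [← win_front, hx, frontPart_snoc]⟩
  · have := congrFun hx (Fin.last m)
    simpa [win] using this

theorem in_injOn {A : Type} [Fintype A] [DecidableEq A] (m : ℕ) (f : ℕ → A) (N : ℕ)
    (v : Fin m → A) (hinj : Set.InjOn (win (m+1) f) (Set.Iio N)) :
    Set.InjOn f ((Finset.range N).filter (fun i => win m f (i+1) = v) : Finset ℕ) := by
  intro i hi j hj hij
  simp only [Finset.coe_filter, Finset.mem_range, Set.mem_ofPred_eq] at hi hj
  apply hinj hi.1 hj.1
  have h := win_eq_iff.1 (hi.2.trans hj.2.symm)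
  rw [win_eq_iff]
  intro t ht
  rcases t with _ | t
  · simpa using hij
  · have := h t (by omega)
    rw [show i + (t+1) = i + 1 + t by omega, show j + (t+1) = j + 1 + t by omega]
    exact this

theorem euler {A : Type} [Fintype A] [DecidableEq A] (m : ℕ) (s : ℕ → A) (K : ℕ)
    (hinj : Set.InjOn (win (m+1) s) (Set.Iio K))
    (T : (Fin m → A) → (Fin (m+1) → A)) (rank : (Fin m → A) → ℕ)
    (hT : ∀ v, v ≠ win m s 0 → frontPart (T v) = v ∧ (∀ i < K, win (m+1) s i ≠ T v) ∧
      rank (Fin.tail (T v)) < rank v) :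
    ∃ (f : ℕ → A) (N : ℕ), (∀ j < K + m, f j = s j) ∧ K ≤ N ∧
      Set.InjOn (win (m+1) f) (Set.Iio N) ∧ ∀ x, ∃ i < N, win (m+1) f i = x := by
  classical
  let Good : (ℕ → A) → ℕ → Prop := fun f N =>
    (∀ j < K + m, f j = s j) ∧ K ≤ N ∧ Set.InjOn (win (m+1) f) (Set.Iio N) ∧
    ∀ v, v ≠ win m s 0 → (∃ i < N, win (m+1) f i = T v) →
      ∀ x, frontPart x = v → ∃ i < N, win (m+1) f i = x
  have hK : ∃ f, Good f K := by
    refine ⟨s, fun _ _ => rfl, le_rfl, hinj, ?_⟩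
    rintro v hv ⟨i, hi, h⟩
    exact absurd h ((hT v hv).2.1 i hi)
  have hB : ∀ N, (∃ f, Good f N) → N ≤ Fintype.card (Fin (m+1) → A) := by
    rintro N ⟨f, hf⟩
    have := Finset.card_le_card_of_injOn (s := Finset.range N) (t := Finset.univ)
      (win (m+1) f) (by simp) (by simpa using hf.2.2.1)
    simpa using this
  obtain ⟨N, ⟨f, hf⟩, hmax⟩ : ∃ N, (∃ f, Good f N) ∧ ¬ ∃ f, Good f (N+1) := by
    by_contra hcon
    push Not at hcon
    have : ∀ d, ∃ f, Good f (K + d) := by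
      intro d
      induction d with
      | zero => exact hK
      | succ d ih => exact hcon _ ih
    have := hB _ (this (Fintype.card (Fin (m+1) → A) + 1))
    omega
  obtain ⟨hfs, hKN, hfi, hfT⟩ := hf
  -- extension
  have hext : ∀ x : Fin (m+1) → A, frontPart x = win m f N → (∀ i < N, win (m+1) f i ≠ x) →
      ∃ f', (∀ j < N + m, f' j = f j) ∧ (∀ i < N, win (m+1) f' i = win (m+1) f i) ∧
        win (m+1) f' N = x := by
    intro x hx _
    have h1 : ∀ j < N + m, Function.update f (N+m) (x (Fin.last m)) j = f j := by
      intro j hj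
      rw [Function.update_of_ne (by omega)]
    refine ⟨Function.update f (N+m) (x (Fin.last m)), h1, ?_, ?_⟩
    · intro i hi
      rw [win_eq_iff]
      intro t ht
      exact h1 _ (by omega)
    · funext j
      refine Fin.lastCases ?_ (fun j => ?_) j
      · simp [win]
      · have := congrFun hx j
        simp only [frontPart, win] at this
        rw [this]
        exact h1 _ (by simp)
  have hall : ∀ x : Fin (m+1) → A, frontPart x = win m f N → ∃ i < N, win (m+1) f i = x := by
    by_contra hcon
    push Not at hcon
    have hch : ∃ x : Fin (m+1) → A, frontPart x = win m f N ∧ (∀ i < N, win (m+1) f i ≠ x) ∧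
        (x = T (win m f N) → ∀ z, frontPart z = win m f N → z ≠ x →
          ∃ i < N, win (m+1) f i = z) := by
      by_cases h : ∃ x : Fin (m+1) → A, frontPart x = win m f N ∧ (∀ i < N, win (m+1) f i ≠ x) ∧
        x ≠ T (win m f N)
      · obtain ⟨x, h1, h2, h3⟩ := h
        exact ⟨x, h1, h2, fun h => absurd h h3⟩
      · push Not at h
        obtain ⟨x, h1, h2⟩ := hcon
        refine ⟨x, h1, h2, ?_⟩
        intro hxT z hz hzx
        by_contra hc
        push Not at hc
        exact hzx ((h z hz hc).trans hxT.symm)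
    obtain ⟨x, hx1, hx2, hx3⟩ := hch
    obtain ⟨f', hf1, hf2, hf3⟩ := hext x hx1 hx2
    apply hmax
    refine ⟨f', fun j hj => (hf1 j (by omega)).trans (hfs j hj), by omega, ?_, ?_⟩
    · intro i hi j hj hij
      simp only [Set.mem_Iio] at hi hj
      rcases Nat.lt_succ_iff_lt_or_eq.1 hi with hi | hi <;>
        rcases Nat.lt_succ_iff_lt_or_eq.1 hj with hj | hj
      · rw [hf2 i hi, hf2 j hj] at hij
        exact hfi hi hj hij
      · subst hj
        rw [hf2 i hi, hf3] at hij
        exact absurd hij (hx2 i hi)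
      · subst hi
        rw [hf2 j hj, hf3] at hij
        exact absurd hij.symm (hx2 j hj)
      · omega
    · rintro v hv ⟨i, hi, hiT⟩ z hz
      rcases Nat.lt_succ_iff_lt_or_eq.1 hi with hi | hi
      · rw [hf2 i hi] at hiT
        obtain ⟨i', hi', h'⟩ := hfT v hv ⟨i, hi, hiT⟩ z hz
        exact ⟨i', by omega, by rw [hf2 i' hi', h']⟩
      · subst hi
        rw [hf3] at hiT
        have hvN : v = win m f i := by
          rw [← (hT v hv).1, ← hiT, hx1]
        subst hvN
        by_cases hzx : z = x
        · exact ⟨i, by omega, by rw [hf3, hzx]⟩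
        · obtain ⟨i', hi', h'⟩ := hx3 hiT z hz hzx
          exact ⟨i', by omega, by rw [hf2 i' hi', h']⟩
  have h0 : win m f 0 = win m s 0 := by
    rw [win_eq_iff]; intro t ht; exact hfs _ (by omega)
  have hin : ∀ v, ((Finset.range N).filter (fun i => win m f (i+1) = v)).card
      ≤ Fintype.card A := by
    intro v
    rw [← Finset.card_univ]
    exact Finset.card_le_card_of_injOn f (by simp) (in_injOn m f N v hfi)
  have hclosed : win m f 0 = win m f N := by
    by_contra hne
    have h1 := balance m f N (win m f N)
    have h2 := out_card m f N _ hall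
    have h3 := hin (win m f N)
    simp only [if_neg hne, if_true] at h1
    omega
  have hrank : ∀ r v, rank v ≤ r → ∀ x, frontPart x = v → ∃ i < N, win (m+1) f i = x := by
    intro r
    induction r with
    | zero =>
      intro v hr
      by_cases hv : v = win m s 0
      · rw [hv, ← h0, hclosed]; exact hall
      · have := (hT v hv).2.2
        omega
    | succ r ih =>
      intro v hr
      by_cases hv : v = win m s 0
      · rw [hv, ← h0, hclosed]; exact hall
      · obtain ⟨hT1, hT2, hT3⟩ := hT v hv
        have hout := out_card m f N _ (ih (Fin.tail (T v)) (by omega))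
        have hb := balance m f N (Fin.tail (T v))
        rw [hclosed] at hb
        have hsurj := Finset.surj_on_of_inj_on_of_card_le
          (s := (Finset.range N).filter (fun i => win m f (i+1) = Fin.tail (T v)))
          (t := (Finset.univ : Finset A)) (fun i _ => f i) (by simp)
          (fun i j hi hj hij => in_injOn m f N _ hfi (by simpa using hi) (by simpa using hj) hij)
          (by rw [Finset.card_univ]; omega) (T v 0) (Finset.mem_univ _)
        obtain ⟨i, hi, hi0⟩ := hsurj
        simp only [Finset.mem_filter, Finset.mem_range] at hi
        apply hfT v hv ⟨i, hi.1, ?_⟩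
        funext j
        refine Fin.cases ?_ (fun j => ?_) j
        · simp [win, hi0]
        · have := congrFun hi.2 j
          rw [← win_tail] at this
          exact this
  exact ⟨f, N, hfs, hKN, hfi, fun x => hrank _ _ le_rfl x rfl⟩

/-- The sequence `0 1^{k-2} 0 (0 1^{k-1})^∞`. -/
def perSeq (k : ℕ) (j : ℕ) : Fin 2 := if k ∣ j ∨ j = k - 1 then 0 else 1

theorem sq_zero {k j : ℕ} : perSeq k j = 0 ↔ (k ∣ j ∨ j = k - 1) := by
  unfold perSeq; split_ifs with h <;> simp [h]

theorem sq_inj (m k : ℕ) (hk2 : 2 ≤ k) (hkm : k ≤ m) :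
    Set.InjOn (win (m+1) (perSeq k)) (Set.Iio (2*k)) := by
  have key : ∀ i j, i < j → j < 2*k → win (m+1) (perSeq k) i = win (m+1) (perSeq k) j → False := by
    intro i j hij hj h
    rw [win_eq_iff] at h
    by_cases hi : i < k
    · have h1 := h (k-1-i) (by omega)
      have h2 := h (k-i) (by omega)
      rw [sq_zero.2 (by right; omega), eq_comm, sq_zero] at h1
      rw [sq_zero.2 (by left; rw [show i + (k-i) = k by omega]), eq_comm, sq_zero] at h2
      have h1' : k ∣ j + (k-1-i) := h1.resolve_right (by omega)
      have h2' : k ∣ j + (k-i) := h2.resolve_right (by omega)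
      have := (Nat.dvd_add_right h1').1
        (by rw [show j + (k-1-i) + 1 = j + (k-i) by omega]; exact h2' : k ∣ j + (k-1-i) + 1)
      have := Nat.le_of_dvd (by omega) this
      omega
    · have h1 := h (2*k-i) (by omega)
      rw [sq_zero.2 (by left; exact ⟨2, by omega⟩), eq_comm, sq_zero] at h1
      have h1' : k ∣ j + (2*k-i) := h1.resolve_right (by omega)
      have := (Nat.dvd_add_right (⟨2, by omega⟩ : k ∣ 2*k)).1
        (by rw [show 2*k + (j - i) = j + (2*k-i) by omega]; exact h1')
      have := Nat.le_of_dvd (by omega) this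
      omega
  intro i hi j hj h
  simp only [Set.mem_Iio] at hi hj
  rcases lt_trichotomy i j with h1 | h1 | h1
  · exact (key i j h1 hj h).elim
  · exact h1
  · exact (key j i h1 hi h.symm).elim

/-- Reachability of the root by unused edges. -/
def Reach (m k M : ℕ) (v : Fin m → Fin 2) : Prop :=
  ∃ g : ℕ → Fin 2, win m g 0 = v ∧ win m g M = win m (perSeq k) 0 ∧
    ∀ i < M, win m g i ≠ win m (perSeq k) 0 → ∀ i' < 2*k, win (m+1) (perSeq k) i' ≠ win (m+1) g i

theorem exists_mult (k : ℕ) (hk : 2 ≤ k) (a : ℕ) : ∃ t < k, k ∣ a + t := by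
  refine ⟨(k - a % k) % k, Nat.mod_lt _ (by omega), ?_⟩
  have h1 := Nat.mod_lt a (show k > 0 by omega)
  rw [Nat.dvd_iff_mod_eq_zero, Nat.add_mod, Nat.mod_mod]
  by_cases h : a % k = 0
  · simp [h]
  · rw [Nat.mod_eq_of_lt (show k - a % k < k by omega), Nat.add_sub_cancel' h1.le, Nat.mod_self]

theorem reach_A (m k : ℕ) (hk2 : 2 ≤ k) (hkm : k ≤ m) (p : ℕ → Fin 2)
    (hp : (¬ ∀ t, m - k + 1 ≤ t → t < m → p t = 1) ∨ (∀ t, m - k ≤ t → t < m → p t = 1)) :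
    Reach m k (2*m-1) (win m p 0) := by
  let g : ℕ → Fin 2 := fun t => if t < m then p t else if t < 2*m then 0 else perSeq k (t - (2*m-1))
  have g1 : ∀ t, t < m → g t = p t := fun t ht => by simp [g, ht]
  have g2 : ∀ t, m ≤ t → t < 2*m → g t = 0 := fun t h1 h2 => by
    simp [g, h2, show ¬ t < m by omega]
  have g3 : ∀ t, 2*m-1 ≤ t → g t = perSeq k (t - (2*m-1)) := fun t ht => by
    rcases Nat.eq_or_lt_of_le ht with h | h
    · rw [g2 t (by omega) (by omega), eq_comm, sq_zero]; left; simp [← h]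
    · simp [g, show ¬ t < m by omega, show ¬ t < 2*m by omega]
  refine ⟨g, ?_, ?_, ?_⟩
  · rw [win_eq_iff]; intro t ht; rw [g1 _ (by omega)]
  · rw [win_eq_iff]; intro t ht; rw [g3 _ (by omega)]; congr 1; omega
  · intro i hi hne i' hi' h
    have hne' : i' ≠ 0 := by
      rintro rfl
      apply hne
      rw [← win_front, ← h, win_front]
    rw [win_eq_iff] at h
    by_cases him : i < m
    · have hm := h m (by omega)
      rw [g2 _ (by omega) (by omega), sq_zero] at hm
      have hd : k ∣ i' + m := hm.resolve_right (by omega)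
      have hones : ∀ t, m - k + 1 ≤ t → t < m → g (i + t) = 1 := by
        intro t h1 h2
        rw [← h t (by omega)]
        have : ¬ perSeq k (i' + t) = 0 := by
          rw [sq_zero]
          rintro (h3 | h3)
          · have := (Nat.dvd_add_right h3).1
              (by rw [show i' + t + (m - t) = i' + m by omega]; exact hd)
            have := Nat.le_of_dvd (by omega) this
            omega
          · have h4 : k ∣ k + (m - t - 1) := by
              rw [show k + (m-t-1) = i' + m by omega]; exact hd
            have h5 : m - t - 1 = 0 := by
              have := (Nat.dvd_add_right (dvd_refl k)).1 h4
              exact Nat.eq_zero_of_dvd_of_lt this (by omega)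
            omega
        omega
      rcases Nat.eq_zero_or_pos i with h0 | h0
      · subst h0
        rcases hp with hp | hp
        · apply hp
          intro t h1 h2
          have := hones t h1 h2
          rwa [g1 _ (by omega), zero_add] at this
        · have h1 := h (m-k) (by omega)
          rw [g1 _ (by omega), zero_add, hp _ le_rfl (by omega)] at h1
          rw [sq_zero.2 (by
            left
            apply (Nat.dvd_add_left (dvd_refl k)).1
            rw [show i' + (m-k) + k = i' + m by omega]; exact hd)] at h1
          simp at h1
      · have := hones (m-1) (by omega) (by omega)
        rw [g2 _ (by omega) (by omega)] at this
        simp at this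
    · have a0 := h 0 (by omega)
      have a1 := h 1 (by omega)
      rw [g2 _ (by omega) (by omega), sq_zero] at a0 a1
      have hik : i' = k - 1 := by
        rcases a0 with a0 | a0
        · exfalso
          rcases a1 with a1 | a1
          · have := (Nat.dvd_add_right a0).1 a1
            have := Nat.le_of_dvd (by omega) this
            omega
          · have := Nat.le_of_dvd (by omega) a0
            omega
        · omega
      have hone : ∀ t, 2 ≤ t → t ≤ k → g (i + t) = 1 := by
        intro t h1 h2
        rw [← h t (by omega)]
        have : ¬ perSeq k (i' + t) = 0 := by
          rw [sq_zero]
          rintro (h3 | h3)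
          · rw [show i' + t = k + (t-1) by omega] at h3
            have := (Nat.dvd_add_right (dvd_refl k)).1 h3
            have := Nat.le_of_dvd (by omega) this
            omega
          · omega
        omega
      by_cases hi2 : i + 2 < 2*m
      · have := hone 2 le_rfl hk2
        rw [g2 _ (by omega) hi2] at this
        simp at this
      · have := hone k hk2 le_rfl
        rw [g3 _ (by omega), sq_zero.2 (by right; omega)] at this
        simp at this

theorem reach_all (m k : ℕ) (hk2 : 2 ≤ k) (hkm : k ≤ m) (v : Fin m → Fin 2) :
    ∃ M, Reach m k M v := by
  let p : ℕ → Fin 2 := fun t => if h : t < m then v ⟨t, h⟩ else 1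
  have hv : win m p 0 = v := by
    funext j; simp [win, p]
  have hp1 : ∀ t, m ≤ t → p t = 1 := fun t ht => by simp [p, show ¬ t < m by omega]
  by_cases hc : ∀ t, m - k + 1 ≤ t → t < m → p t = 1
  · obtain ⟨g, hg1, hg2, hg3⟩ := reach_A m k hk2 hkm (fun t => p (t+1)) (by
      right
      intro t h1 h2
      by_cases h : t + 1 < m
      · exact hc _ (by omega) h
      · exact hp1 _ (by omega))
    rw [win_eq_iff] at hg1
    simp only [zero_add] at hg1
    let g' : ℕ → Fin 2 := fun t => if t = 0 then p 0 else g (t-1)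
    have hg's : ∀ l i, win l g' (i+1) = win l g i := by
      intro l i
      rw [win_eq_iff]
      intro t ht
      have e : i + 1 + t - 1 = i + t := by omega
      simp only [g', if_neg (show ¬ (i + 1 + t = 0) by omega), e]
    have hg'p : ∀ t, t ≤ m → g' t = p t := by
      intro t ht
      rcases t with _ | t
      · simp [g']
      · simp [g', hg1 t (by omega)]
    refine ⟨2*m-1+1, g', ?_, ?_, ?_⟩
    · rw [← hv, win_eq_iff]
      intro t ht
      rw [hg'p _ (by omega)]
    · rw [hg's, hg2]
    · intro i hi hne i' hi' h
      rcases i with _ | i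
      · rw [win_eq_iff] at h
        obtain ⟨t, ht, htd⟩ := exists_mult k hk2 (i' + (m - k + 1))
        have := h (m - k + 1 + t) (by omega)
        rw [sq_zero.2 (by left; rw [← add_assoc]; exact htd), hg'p _ (by omega), zero_add] at this
        have h1 : p (m-k+1+t) = 1 := by
          by_cases hh : m - k + 1 + t < m
          · exact hc _ (by omega) hh
          · exact hp1 _ (by omega)
        rw [h1] at this
        simp at this
      · rw [hg's] at hne h
        exact hg3 i (by omega) hne i' hi' h
  · exact ⟨2*m-1, hv ▸ reach_A m k hk2 hkm p (Or.inl hc)⟩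

theorem exists_seq (m k : ℕ) (hk2 : 2 ≤ k) (hkm : k ≤ m) :
    ∃ (f : ℕ → Fin 2) (N : ℕ), (∀ j < 2*k + m, f j = perSeq k j) ∧ 2*k ≤ N ∧
      Set.InjOn (win (m+1) f) (Set.Iio N) ∧ ∀ x, ∃ i < N, win (m+1) f i = x := by
  classical
  have hR := reach_all m k hk2 hkm
  have hT : ∀ v : Fin m → Fin 2, ∃ x : Fin (m+1) → Fin 2, v ≠ win m (perSeq k) 0 →
      frontPart x = v ∧ (∀ i < 2*k, win (m+1) (perSeq k) i ≠ x) ∧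
      Nat.find (hR (Fin.tail x)) < Nat.find (hR v) := by
    intro v
    by_cases hv : v = win m (perSeq k) 0
    · exact ⟨fun _ => 0, fun h => absurd hv h⟩
    · have hs := Nat.find_spec (hR v)
      generalize hM : Nat.find (hR v) = M at hs
      obtain ⟨g, h1, h2, h3⟩ := hs
      rcases M with _ | M
      · exact absurd (h1.symm.trans h2) hv
      · refine ⟨win (m+1) g 0, fun _ => ⟨by rw [win_front, h1],
          h3 0 (by omega) (by rw [h1]; exact hv), ?_⟩⟩
        have hsh : ∀ l i, win l (fun t => g (t+1)) i = win l g (i+1) := by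
          intro l i
          rw [win_eq_iff]
          intro t ht
          congr 1; omega
        have : Reach m k M (Fin.tail (win (m+1) g 0)) := by
          refine ⟨fun t => g (t+1), ?_, ?_, ?_⟩
          · rw [win_tail, hsh]
          · rw [hsh, h2]
          · intro i hi
            rw [hsh, hsh]
            exact h3 (i+1) (by omega)
        have := Nat.find_min' (hR (Fin.tail (win (m+1) g 0))) this
        omega
  choose T hT using hT
  exact euler m (perSeq k) (2*k) (sq_inj m k hk2 hkm) T (fun v => Nat.find (hR v)) hT

theorem sq_period {k j : ℕ} (hj : j + 1 ≠ k) (hk : 2 ≤ k) : perSeq k (j + k) = perSeq k j := by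
  unfold perSeq
  simp only [Nat.dvd_add_self_right]
  simp only [show ¬ (j + k = k - 1) by omega, show ¬ (j = k - 1) by omega]

theorem fin2_ne {a b : Fin 2} (h : a ≠ b) : a = 1 - b := by omega

theorem sq_getD (k t : ℕ) (hk : 2 ≤ k) :
    (((0 : Fin 2) :: List.replicate (k - 1) (1 : Fin 2)).getD (t % k) 0) = perSeq k (t + 2*k) := by
  have h1 := Nat.mod_lt t (show k > 0 by omega)
  have h2 : k ∣ t + 2*k ↔ t % k = 0 := by
    rw [(Nat.dvd_add_left (Dvd.intro_left 2 rfl)), Nat.dvd_iff_mod_eq_zero]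
  unfold perSeq
  simp only [h2]
  clear h2
  generalize t % k = r at *
  rcases r with _ | r
  · simp
  · simp [show r < k - 1 by omega]
    omega

/-- For `A = {0,1}`, any `n ≥ 3` and any `k ∈ {2,…,n-1}`, there exists a
linear upword for `A^n` with a single `◊` at position `k` beginning with
`0 1^{k-2} ◊ c(0 1^{k-1}, n)`. -/
theorem upword_diamond_at_pos_k (n k : ℕ) (hn : 3 ≤ n) (hk2 : 2 ≤ k) (hkn : k ≤ n - 1) :
    ∃ u : List (PSym 2), IsLinearUpword 2 n u ∧ u.count (none : PSym 2) = 1 ∧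
      ((some (0 : Fin 2) :: List.replicate (k - 2) (some (1 : Fin 2))) ++ [none] ++
        (cword ((0 : Fin 2) :: List.replicate (k - 1) (1 : Fin 2)) n).map some) <+: u := by
  obtain ⟨m, rfl⟩ : ∃ m, n = m + 1 := ⟨n - 1, by omega⟩
  simp only [Nat.add_sub_cancel] at hkn
  obtain ⟨f, N, hfs, hKN, hfi, hfsurj⟩ := exists_seq m k hk2 hkn
  have hN : 2*k < N := by
    have h1 : Fintype.card (Fin (m+1) → Fin 2) ≤ N := by
      rw [← Finset.card_univ, ← Finset.card_range N]
      apply Finset.card_le_card_of_surjOn (win (m+1) f)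
      intro x _
      obtain ⟨i, hi, h⟩ := hfsurj x
      exact ⟨i, by simpa using hi, h⟩
    simp at h1
    have := Nat.lt_two_pow_self (n := m)
    rw [pow_succ] at h1
    omega
  have hper : ∀ j, j + k < 2*k+m → j + 1 ≠ k → f (j + k) = f j := by
    intro j h1 h2
    rw [hfs _ h1, hfs _ (by omega), sq_period h2 hk2]
  have hf0 : f (k-1) = 0 := by
    rw [hfs _ (by omega), sq_zero]; right; rfl
  have hf1 : f (k-1+k) = 1 := by
    rw [hfs _ (by omega)]
    have : ¬ perSeq k (k-1+k) = 0 := by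
      rw [sq_zero, Nat.dvd_add_self_right]
      rintro (h | h)
      · have := Nat.le_of_dvd (by omega) h
        omega
      · omega
    omega
  have hlast : f (2*k+m) = 1 - perSeq k (m + 2*k) := by
    apply fin2_ne
    intro h
    have : win (m+1) f (2*k) = win (m+1) f k := by
      rw [win_eq_iff]
      intro t ht
      by_cases htm : t = m
      · subst htm
        rw [h, hfs _ (by omega), show t + 2*k = k + t + k by omega, sq_period (by omega) hk2]
      · rw [show 2*k + t = k + t + k by omega, hper _ (by omega) (by omega)]
    have := hfi (by simpa using hN) (by simp; omega) this
    omega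
  let uf : ℕ → PSym 2 := fun j => if j = k - 1 then none else some (f (j + k))
  let u : List (PSym 2) := (List.range (N + m - k)).map uf
  have hul : u.length = N + m - k := by simp [u]
  have hu : ∀ j, j < N + m - k → u[j]? = some (uf j) := by
    intro j hj
    simp [u, hj]
  refine ⟨u, ?_, ?_, ?_⟩
  · intro v hv
    obtain ⟨p, hpN, hp⟩ := hfsurj (fun j => v[j.1]'(by rw [hv]; exact j.2))
    have hp' : ∀ j (hj : j < m + 1), f (p + j) = v[j]'(by rw [hv]; exact hj) := by
      intro j hj
      exact congrFun hp ⟨j, hj⟩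
    have hm : ∀ i, MatchAt u v i ↔ (i + (m+1) ≤ N + m - k ∧
        ∀ j < m+1, i + j = k - 1 ∨ f (i + j + k) = f (p + j)) := by
      intro i
      unfold MatchAt
      rw [hv, hul]
      refine and_congr_right fun h => forall₂_congr fun j hj => ?_
      rw [hu _ (by omega), List.getElem?_eq_getElem (by rw [hv]; exact hj), hp' j hj]
      simp only [uf]
      split_ifs with hc <;> simp [hc]
    have huniq : ∀ i, MatchAt u v i → (p = i + k ∨ (i < k ∧ p = i)) := by
      intro i hi
      obtain ⟨h1, h2⟩ := (hm i).1 hi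
      by_cases hik : i < k
      · by_cases hz : f (p + (k-1-i)) = 0
        · right
          refine ⟨hik, hfi hpN (by simp; omega) ?_⟩
          rw [win_eq_iff]
          intro t ht
          by_cases htk : t = k-1-i
          · rw [htk, hz, show i + (k-1-i) = k-1 by omega, hf0]
          · rw [← (h2 t ht).resolve_left (by omega), hper _ (by omega) (by omega)]
        · left
          refine hfi hpN (by simp; omega) ?_
          rw [win_eq_iff]
          intro t ht
          by_cases htk : t = k-1-i
          · rw [htk, show i + k + (k-1-i) = k-1+k by omega, hf1]
            omega
          · rw [← (h2 t ht).resolve_left (by omega)]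
            congr 1; omega
      · left
        refine hfi hpN (by simp; omega) ?_
        rw [win_eq_iff]
        intro t ht
        rw [← (h2 t ht).resolve_left (by omega)]
        congr 1; omega
    by_cases hpk : p < k
    · refine ⟨p, (hm p).2 ⟨by omega, ?_⟩, ?_⟩
      · intro j hj
        by_cases h : p + j = k - 1
        · left; exact h
        · right; exact hper _ (by omega) (by omega)
      · intro i hi
        have := huniq i hi
        omega
    · refine ⟨p - k, (hm _).2 ⟨by omega, ?_⟩, ?_⟩
      · intro j hj
        right; congr 1; omega
      · intro i hi
        have := huniq i hi
        omega
  · have : u.count none = (List.range (N + m - k)).count (k-1) := by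
      simp only [u, List.count, List.countP_map]
      congr 1
      funext j
      by_cases h : j = k - 1 <;> simp [uf, h]
    rw [this]
    exact List.count_eq_one_of_mem List.nodup_range (by simp; omega)
  · rw [List.prefix_iff_getElem?]
    intro j hj
    simp [cword] at hj
    rw [hu j (by omega)]
    congr 1
    by_cases h1 : j < k - 1
    · rw [List.getElem_append_left (by simp; omega), List.getElem_append_left (by simp; omega)]
      simp only [uf, if_neg (show ¬ j = k - 1 by omega)]
      rw [hper _ (by omega) (by omega), hfs _ (by omega)]
      rcases j with _ | j
      · simp [sq_zero]
      · simp
        have : ¬ perSeq k (j+1) = 0 := by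
          rw [sq_zero]
          rintro (h | h)
          · have := Nat.le_of_dvd (by omega) h
            omega
          · omega
        omega
    · by_cases h2 : j = k - 1
      · subst h2
        rw [List.getElem_append_left (by simp; omega),
          List.getElem_append_right (by simp; omega)]
        simp [uf]
      · rw [List.getElem_append_right (by simp; omega)]
        obtain ⟨t, rfl⟩ : ∃ t, j = k + t := ⟨j - k, by omega⟩
        have hlen : ((some (0 : Fin 2) :: List.replicate (k - 2) (some (1 : Fin 2)))
          ++ [(none : PSym 2)]).length = k := by simp; omega
        have hwl : ((0 : Fin 2) :: List.replicate (k - 1) (1 : Fin 2)).length = k := by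
          simp; omega
        simp only [hlen, Nat.add_sub_cancel_left, uf, if_neg h2, List.getElem_map, cword,
          List.getElem_range, hwl, sq_getD _ _ hk2]
        congr 1
        rw [Nat.add_sub_cancel]
        by_cases htm : t < m
        · rw [if_pos htm, hfs _ (by omega)]
          congr 1; omega
        · rw [if_neg htm, show k + t + k = 2*k+m by omega, hlast]
end

section
/- For A = {0,1} and any n ≥ 4, there exists a linear universal partial word for A^n with exactly two ◊s that begins with ◊ 0^{n-1} 1^{n-2} ◊ 1 0^{n-2} 1. -/
/-- The prescribed prefix, for `n = m + 2`. -/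
def pre (m : ℕ) : List (PSym 2) :=
  none :: (List.replicate (m + 1) (some (0 : Fin 2)) ++
        List.replicate m (some (1 : Fin 2)) ++ [none, some (1 : Fin 2)] ++
        List.replicate m (some (0 : Fin 2)) ++ [some (1 : Fin 2)])

/-- Pointwise values of the prefix. -/
def pv (m p : ℕ) : Option (Fin 2) :=
  if p = 0 then none else if p < m + 2 then some 0 else if p < 2 * m + 2 then some 1
  else if p = 2 * m + 2 then none else if p = 2 * m + 3 then some 1
  else if p < 3 * m + 4 then some 0 else some 1

lemma pre_length (m : ℕ) : (pre m).length = 3 * m + 5 := by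
  simp [pre]; omega

lemma pre_get (m p : ℕ) (hp : p < 3 * m + 5) : (pre m)[p]? = some (pv m p) := by
  unfold pre pv
  rcases p with _ | p
  · simp
  · simp only [List.getElem?_cons_succ]
    grind

lemma match_pre (m : ℕ) (v : List (Fin 2)) (hv : v.length = m + 2) (i : ℕ) :
    MatchAt (pre m) v i ↔ i ≤ 2 * m + 3 ∧
      ∀ j < m + 2, pv m (i + j) = none ∨ v[j]? = pv m (i + j) := by
  unfold MatchAt
  rw [pre_length, hv]
  constructor
  · rintro ⟨h1, h2⟩
    refine ⟨by omega, fun j hj => ?_⟩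
    have := h2 j hj
    rw [pre_get _ _ (by omega)] at this
    have hj' : j < v.length := by omega
    simp only [List.getElem?_eq_getElem hj', Option.map_some, Option.some.injEq] at this ⊢
    tauto
  · rintro ⟨h1, h2⟩
    refine ⟨by omega, fun j hj => ?_⟩
    have := h2 j hj
    rw [pre_get _ _ (by omega)]
    have hj' : j < v.length := by omega
    simp only [List.getElem?_eq_getElem hj', Option.map_some, Option.some.injEq] at this ⊢
    tauto

lemma match_pre_lt (m : ℕ) (hm : 2 ≤ m) (v : List (Fin 2)) (hv : v.length = m + 2) (i j : ℕ)
    (hi : MatchAt (pre m) v i) (hj : MatchAt (pre m) v j) : ¬ i < j := by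
  intro hij
  rw [match_pre m v hv] at hi hj
  obtain ⟨hi1, hi⟩ := hi
  obtain ⟨hj1, hj⟩ := hj
  have key : ∀ k < m + 2, pv m (i + k) = none ∨ pv m (j + k) = none ∨
      pv m (i + k) = pv m (j + k) := by
    intro k hk
    rcases hi k hk with h | h
    · exact Or.inl h
    rcases hj k hk with h' | h'
    · exact Or.inr (Or.inl h')
    · exact Or.inr (Or.inr (h.symm.trans h'))
  clear hi hj hv
  by_cases c1 : m + 2 ≤ i
  · by_cases c2 : j = 2 * m + 3
    · by_cases c3 : i = m + 2
      · replace key := key 1 (by omega)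
        grind (splits := 40) [pv]
      · replace key := key (m + 1) (by omega)
        grind (splits := 40) [pv]
    · replace key := key (2 * m + 3 - i) (by omega)
      grind (splits := 40) [pv]
  · by_cases c2 : j = 2 * m + 3
    · by_cases c3 : i = 0
      · replace key := key (m + 1) (by omega)
        grind (splits := 40) [pv]
      · replace key := key 0 (by omega)
        grind (splits := 40) [pv]
    · by_cases c3 : m + 2 ≤ j
      · by_cases c4 : i = 0
        · replace key := key (2 * m + 3 - j) (by omega)
          grind (splits := 40) [pv]
        · by_cases c5 : j = 2 * m + 2
          · by_cases c6 : i = m + 1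
            · replace key := key 2 (by omega)
              grind (splits := 40) [pv]
            · replace key := key 1 (by omega)
              grind (splits := 40) [pv]
          · replace key := key 0 (by omega)
            grind (splits := 40) [pv]
      · replace key := key (m + 2 - j) (by omega)
        grind (splits := 40) [pv]

/-- Words determined by the prefix. -/
def Cov (m : ℕ) (w : List (Fin 2)) : Prop :=
  (∃ a b, a + b = m + 2 ∧ w = List.replicate a 0 ++ List.replicate b 1) ∨
  (∃ a b, a + b = m + 2 ∧ w = List.replicate a 1 ++ List.replicate b 0) ∨
  (∃ a b, a + b = m ∧ w = List.replicate a 1 ++ 0 :: 1 :: List.replicate b 0) ∨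
  w = 0 :: (List.replicate m 1 ++ [0]) ∨ w = 1 :: (List.replicate m 0 ++ [1])

lemma cov_length {m : ℕ} {w : List (Fin 2)} (h : Cov m w) : w.length = m + 2 := by
  rcases h with ⟨a, b, h, rfl⟩ | ⟨a, b, h, rfl⟩ | ⟨a, b, h, rfl⟩ | rfl | rfl <;> simp <;> omega

lemma match_of_cov (m : ℕ) (hm : 2 ≤ m) (w : List (Fin 2)) (h : Cov m w) :
    ∃ i, MatchAt (pre m) w i := by
  have hl := cov_length h
  have fin : ∀ i, (i ≤ 2 * m + 3 ∧
      ∀ j < m + 2, pv m (i + j) = none ∨ w[j]? = pv m (i + j)) → ∃ i, MatchAt (pre m) w i :=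
    fun i hi => ⟨i, (match_pre m w hl i).2 hi⟩
  rcases h with ⟨a, b, h, rfl⟩ | ⟨a, b, h, rfl⟩ | ⟨a, b, h, rfl⟩ | rfl | rfl
  · apply fin (if a = 0 then m + 2 else b)
    refine ⟨by split_ifs <;> omega, fun j hj => ?_⟩
    grind (splits := 40) [pv]
  · apply fin (if b = 0 then m + 2 else if a = 0 then 0 else if a = 1 then 0 else m + 2 + b)
    refine ⟨by split_ifs <;> omega, fun j hj => ?_⟩
    grind (splits := 40) [pv]
  · apply fin (m + 2 + b)
    refine ⟨by omega, fun j hj => ?_⟩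
    grind (splits := 40) [pv]
  · apply fin (m + 1)
    refine ⟨by omega, fun j hj => ?_⟩
    grind (splits := 40) [pv]
  · apply fin (2 * m + 3)
    refine ⟨by omega, fun j hj => ?_⟩
    grind (splits := 40) [pv]

lemma cov_of_match (m : ℕ) (hm : 2 ≤ m) (w : List (Fin 2)) (hw : w.length = m + 2)
    (i : ℕ) (h : MatchAt (pre m) w i) : Cov m w := by
  rw [match_pre m w hw] at h
  obtain ⟨hi, h⟩ := h
  have two : ∀ j < m + 2, w[j]? = some 0 ∨ w[j]? = some 1 := by
    intro j hj
    have hj' : j < w.length := by omega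
    rw [List.getElem?_eq_getElem hj']
    generalize w[j] = c
    fin_cases c <;> simp
  have none : ∀ j, m + 2 ≤ j → w[j]? = none := fun j hj => by simp; omega
  by_cases c0 : i = 0
  · rcases two 0 (by omega) with h0 | h0
    · left
      refine ⟨m + 2, 0, by omega, List.ext_getElem? fun j => ?_⟩
      replace h := h j
      replace none := none j
      grind (splits := 40) [pv]
    · right; left
      refine ⟨1, m + 1, by omega, List.ext_getElem? fun j => ?_⟩
      replace h := h j
      replace none := none j
      grind (splits := 40) [pv]
  by_cases c1 : i < m + 1
  · left
    refine ⟨m + 2 - i, i, by omega, List.ext_getElem? fun j => ?_⟩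
    replace h := h j
    replace none := none j
    grind (splits := 40) [pv]
  by_cases c2 : i = m + 1
  · rcases two (m + 1) (by omega) with h0 | h0
    · right; right; right; left
      refine List.ext_getElem? fun j => ?_
      replace h := h j
      replace none := none j
      grind (splits := 40) [pv]
    · left
      refine ⟨1, m + 1, by omega, List.ext_getElem? fun j => ?_⟩
      replace h := h j
      replace none := none j
      grind (splits := 40) [pv]
  by_cases c3 : i < 2 * m + 3
  · rcases two (2 * m + 2 - i) (by omega) with h0 | h0
    · right; right; left
      refine ⟨2 * m + 2 - i, i - (m + 2), by omega, List.ext_getElem? fun j => ?_⟩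
      replace h := h j
      replace none := none j
      grind (splits := 40) [pv]
    · by_cases c4 : i = m + 2
      · left
        refine ⟨0, m + 2, by omega, List.ext_getElem? fun j => ?_⟩
        replace h := h j
        replace none := none j
        grind (splits := 40) [pv]
      · right; left
        refine ⟨2 * m + 4 - i, i - (m + 2), by omega, List.ext_getElem? fun j => ?_⟩
        replace h := h j
        replace none := none j
        grind (splits := 40) [pv]
  · right; right; right; right
    refine List.ext_getElem? fun j => ?_
    replace h := h j
    replace none := none j
    grind (splits := 40) [pv]

def XX (m : ℕ) (y : List (Fin 2)) : Prop :=
  (∃ a b, a + b = m + 1 ∧ y = List.replicate a 1 ++ List.replicate b 0) ∨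
  (∃ a b, a + b + 1 = m ∧ y = List.replicate a 1 ++ 0 :: 1 :: List.replicate b 0)

def ZZ (m : ℕ) (y : List (Fin 2)) : Prop :=
  (∃ a b, a + b = m + 1 ∧ y = List.replicate a 0 ++ List.replicate b 1) ∨
  y = List.replicate m 1 ++ [0] ∨ y = 1 :: List.replicate m 0

lemma snoc_inj {y l : List (Fin 2)} {c d : Fin 2} (h : y ++ [c] = l ++ [d]) : y = l ∧ c = d := by
  simpa using h

lemma cov_snoc0 (m : ℕ) (hm : 2 ≤ m) (y : List (Fin 2)) :
    Cov m (y ++ [0]) ↔ XX m y ∨ y = 0 :: List.replicate m 1 := by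
  constructor
  · rintro (⟨a, b, h, e⟩ | ⟨a, b, h, e⟩ | ⟨a, b, h, e⟩ | e | e)
    · rcases b with _ | b
      · rcases a with _ | a
        · omega
        · left; left
          simp only [List.replicate_zero, List.append_nil] at e
          rw [List.replicate_succ'] at e
          exact ⟨0, a, by omega, by simpa using (snoc_inj e).1⟩
      · rw [List.replicate_succ', ← List.append_assoc] at e
        exact absurd (snoc_inj e).2 (by decide)
    · rcases b with _ | b
      · rcases a with _ | a
        · omega
        · simp only [List.replicate_zero, List.append_nil] at e
          rw [List.replicate_succ'] at e
          exact absurd (snoc_inj e).2 (by decide)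
      · rw [List.replicate_succ', ← List.append_assoc] at e
        left; left
        exact ⟨a, b, by omega, (snoc_inj e).1⟩
    · rcases b with _ | b
      · have : y ++ [0] = (List.replicate a 1 ++ [0]) ++ [1] := by simpa using e
        exact absurd (snoc_inj this).2 (by decide)
      · have : y ++ [0] = (List.replicate a 1 ++ 0 :: 1 :: List.replicate b 0) ++ [0] := by
          rw [e, List.replicate_succ']; simp
        left; right
        exact ⟨a, b, by omega, (snoc_inj this).1⟩
    · right
      rw [← List.cons_append] at e
      exact (snoc_inj e).1
    · rw [← List.cons_append] at e
      exact absurd (snoc_inj e).2 (by decide)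
  · rintro ((⟨a, b, h, rfl⟩ | ⟨a, b, h, rfl⟩) | rfl)
    · right; left
      exact ⟨a, b + 1, by omega, by rw [List.replicate_succ']; simp⟩
    · right; right; left
      exact ⟨a, b + 1, by omega, by rw [List.replicate_succ']; simp⟩
    · right; right; right; left
      simp

lemma cov_cons1 (m : ℕ) (hm : 2 ≤ m) (y : List (Fin 2)) :
    Cov m (1 :: y) ↔ XX m y ∨ y = List.replicate m 0 ++ [1] := by
  constructor
  · rintro (⟨a, b, h, e⟩ | ⟨a, b, h, e⟩ | ⟨a, b, h, e⟩ | e | e)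
    · rcases a with _ | a
      · rcases b with _ | b
        · omega
        · left; left
          simp only [List.replicate_zero, List.nil_append, List.replicate_succ,
            List.cons.injEq, true_and] at e
          exact ⟨b, 0, by omega, by simpa using e⟩
      · simp [List.replicate_succ] at e
    · rcases a with _ | a
      · rcases b with _ | b
        · omega
        · simp [List.replicate_succ] at e
      · left; left
        simp only [List.replicate_succ, List.cons_append, List.cons.injEq, true_and] at e
        exact ⟨a, b, by omega, e⟩
    · rcases a with _ | a
      · simp at e
      · left; right
        simp only [List.replicate_succ, List.cons_append, List.cons.injEq, true_and] at e
        exact ⟨a, b, by omega, e⟩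
    · simp at e
    · right; simpa using e
  · rintro ((⟨a, b, h, rfl⟩ | ⟨a, b, h, rfl⟩) | rfl)
    · right; left
      exact ⟨a + 1, b, by omega, by simp [List.replicate_succ]⟩
    · right; right; left
      exact ⟨a + 1, b, by omega, by simp [List.replicate_succ]⟩
    · right; right; right; right
      simp

lemma cov_snoc1 (m : ℕ) (hm : 2 ≤ m) (y : List (Fin 2)) : Cov m (y ++ [1]) ↔ ZZ m y := by
  constructor
  · rintro (⟨a, b, h, e⟩ | ⟨a, b, h, e⟩ | ⟨a, b, h, e⟩ | e | e)
    · rcases b with _ | b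
      · rcases a with _ | a
        · omega
        · simp only [List.replicate_zero, List.append_nil] at e
          rw [List.replicate_succ'] at e
          exact absurd (snoc_inj e).2 (by decide)
      · rw [List.replicate_succ', ← List.append_assoc] at e
        left
        exact ⟨a, b, by omega, (snoc_inj e).1⟩
    · rcases b with _ | b
      · rcases a with _ | a
        · omega
        · simp only [List.replicate_zero, List.append_nil] at e
          rw [List.replicate_succ'] at e
          left
          exact ⟨0, a, by omega, by simpa using (snoc_inj e).1⟩
      · rw [List.replicate_succ', ← List.append_assoc] at e
        exact absurd (snoc_inj e).2 (by decide)
    · rcases b with _ | b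
      · have : y ++ [1] = (List.replicate a 1 ++ [0]) ++ [1] := by simpa using e
        right; left
        obtain rfl : a = m := by omega
        exact (snoc_inj this).1
      · have : y ++ [1] = (List.replicate a 1 ++ 0 :: 1 :: List.replicate b 0) ++ [0] := by
          rw [e, List.replicate_succ']; simp
        exact absurd (snoc_inj this).2 (by decide)
    · rw [← List.cons_append] at e
      exact absurd (snoc_inj e).2 (by decide)
    · rw [← List.cons_append] at e
      right; right
      exact (snoc_inj e).1
  · rintro (⟨a, b, h, rfl⟩ | rfl | rfl)
    · left
      exact ⟨a, b + 1, by omega, by rw [List.replicate_succ']; simp⟩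
    · right; right; left
      exact ⟨m, 0, by omega, by simp⟩
    · right; right; right; right
      simp

lemma cov_cons0 (m : ℕ) (hm : 2 ≤ m) (y : List (Fin 2)) : Cov m (0 :: y) ↔ ZZ m y := by
  constructor
  · rintro (⟨a, b, h, e⟩ | ⟨a, b, h, e⟩ | ⟨a, b, h, e⟩ | e | e)
    · rcases a with _ | a
      · rcases b with _ | b
        · omega
        · simp [List.replicate_succ] at e
      · left
        simp only [List.replicate_succ, List.cons_append, List.cons.injEq, true_and] at e
        exact ⟨a, b, by omega, e⟩
    · rcases a with _ | a
      · rcases b with _ | b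
        · omega
        · left
          simp only [List.replicate_zero, List.nil_append, List.replicate_succ,
            List.cons.injEq, true_and] at e
          exact ⟨b, 0, by omega, by simpa using e⟩
      · simp [List.replicate_succ] at e
    · rcases a with _ | a
      · right; right
        obtain rfl : b = m := by omega
        simpa using e
      · simp [List.replicate_succ] at e
    · right; left; simpa using e
    · simp at e
  · rintro (⟨a, b, h, rfl⟩ | rfl | rfl)
    · left
      exact ⟨a + 1, b, by omega, by simp [List.replicate_succ]⟩
    · right; right; right; left
      simp
    · right; right; left
      exact ⟨0, m, by omega, by simp⟩

lemma not_XX_t (m : ℕ) (hm : 2 ≤ m) : ¬ XX m (0 :: List.replicate m 1) := by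
  obtain ⟨m, rfl⟩ : ∃ k, m = k + 2 := ⟨m - 2, by omega⟩
  rintro (⟨a, b, h, e⟩ | ⟨a, b, h, e⟩)
  · rcases a with _ | a
    · rcases b with _ | _ | b <;> simp [List.replicate_succ] at e
    · simp [List.replicate_succ] at e
  · rcases a with _ | a
    · rcases b with _ | b
      · omega
      · simp [List.replicate_succ] at e
    · simp [List.replicate_succ] at e

lemma not_XX_s (m : ℕ) (hm : 2 ≤ m) : ¬ XX m (List.replicate m 0 ++ [1]) := by
  obtain ⟨m, rfl⟩ : ∃ k, m = k + 2 := ⟨m - 2, by omega⟩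
  rintro (⟨a, b, h, e⟩ | ⟨a, b, h, e⟩)
  · rcases a with _ | a
    · have : (1 : Fin 2) ∈ List.replicate b (0 : Fin 2) := by
        have e' : List.replicate (m + 2) (0 : Fin 2) ++ [1] = List.replicate b 0 := by simpa using e
        rw [← e']; simp
      simp [List.mem_replicate] at this
    · simp [List.replicate_succ] at e
  · rcases a with _ | a
    · simp [List.replicate_succ] at e
    · simp [List.replicate_succ] at e

open Classical in
/-- Indicator of a set of words. -/
noncomputable def ind (p : Prop) : ℕ := if p then 1 else 0

lemma cov_bal (m : ℕ) (hm : 2 ≤ m) (y : List (Fin 2)) :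
    ind (Cov m (y ++ [0])) + ind (Cov m (y ++ [1])) + ind (y = List.replicate m 0 ++ [1]) =
    ind (Cov m (0 :: y)) + ind (Cov m (1 :: y)) + ind (y = 0 :: List.replicate m 1) := by
  rw [cov_snoc0 m hm, cov_snoc1 m hm, cov_cons0 m hm, cov_cons1 m hm]
  have h1 := not_XX_t m hm
  have h2 := not_XX_s m hm
  by_cases hX : XX m y
  · have n1 : y ≠ 0 :: List.replicate m 1 := by rintro rfl; exact h1 hX
    have n2 : y ≠ List.replicate m 0 ++ [1] := by rintro rfl; exact h2 hX
    simp only [hX, n1, n2, true_or]; omega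
  · simp only [hX, false_or]; omega

lemma last_zero (y : List (Fin 2)) :
    y = List.replicate y.length 1 ∨ ∃ a k, y = a ++ 0 :: List.replicate k 1 := by
  induction y using List.reverseRecOn with
  | nil => simp
  | append_singleton y c ih =>
    fin_cases c
    · right; exact ⟨y, 0, by simp⟩
    · rcases ih with h | ⟨a, k, h⟩
      · left
        rw [List.length_append, List.length_singleton, List.replicate_succ', ← h]
        rfl
      · right
        refine ⟨a, k + 1, ?_⟩
        rw [h, List.replicate_succ']; simp

lemma not_sorted (a l : List (Fin 2)) (p q : ℕ)
    (h : a ++ 1 :: 0 :: l = List.replicate p 0 ++ List.replicate q 1) : False := by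
  have h1 : (List.replicate p (0 : Fin 2) ++ List.replicate q 1).Pairwise (· ≤ ·) := by
    rw [List.pairwise_append]
    refine ⟨by simp [List.pairwise_replicate], by simp [List.pairwise_replicate], ?_⟩
    intro x hx y hy
    rw [List.mem_replicate] at hx
    rw [hx.2]; exact Fin.zero_le _
  rw [← h, List.pairwise_append] at h1
  have := h1.2.1
  simp at this

lemma reach (m : ℕ) (hm : 2 ≤ m) (S : List (Fin 2) → Prop)
    (hT : S (0 :: List.replicate m 1))
    (hN : ∀ y, y.length = m + 1 → Cov m (y ++ [0]) → Cov m (y ++ [1]) → S y)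
    (h1 : ∀ y, y.length = m + 1 → ¬ Cov m (y ++ [1]) → S (y ++ [1]).tail → S y)
    (h0 : ∀ y, y.length = m + 1 → Cov m (y ++ [1]) → S (y ++ [0]).tail → S y) :
    ∀ y, y.length = m + 1 → S y := by
  have hX : ∀ y, y.length = m + 1 → Cov m (y ++ [1]) → XX m y → S y := fun y hl hc hx =>
    hN y hl ((cov_snoc0 m hm y).2 (Or.inl hx)) hc
  have xa : XX m (List.replicate m 1 ++ [0]) := Or.inl ⟨m, 1, by omega, by simp⟩
  have xb : XX m (1 :: List.replicate m 0) := Or.inl ⟨1, m, by omega, by simp⟩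
  have A : ∀ (a : List (Fin 2)) (k : ℕ), a.length + k + 2 = m + 1 →
      S (a ++ 1 :: 0 :: List.replicate k 1) := by
    intro a
    induction a with
    | nil =>
      intro k hk
      by_cases c : Cov m (([] ++ 1 :: 0 :: List.replicate k 1) ++ [1])
      · rcases (cov_snoc1 m hm _).1 c with ⟨p, q, hpq, e⟩ | e | e
        · exact (not_sorted _ _ _ _ e).elim
        · exact hX _ (by simp at hk ⊢; omega) c (e ▸ xa)
        · exact hX _ (by simp at hk ⊢; omega) c (e ▸ xb)
      · refine h1 _ (by simp at hk ⊢; omega) c ?_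
        convert hT using 1
        obtain rfl : m = k + 1 := by simp at hk; omega
        simp [List.replicate_succ']
    | cons x a ih =>
      intro k hk
      by_cases c : Cov m (((x :: a) ++ 1 :: 0 :: List.replicate k 1) ++ [1])
      · rcases (cov_snoc1 m hm _).1 c with ⟨p, q, hpq, e⟩ | e | e
        · exact (not_sorted _ _ _ _ e).elim
        · exact hX _ (by simp at hk ⊢; omega) c (e ▸ xa)
        · exact hX _ (by simp at hk ⊢; omega) c (e ▸ xb)
      · refine h1 _ (by simp at hk ⊢; omega) c ?_
        convert ih (k + 1) (by simp at hk; omega) using 1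
        simp [List.replicate_succ']
  have B : ∀ (a : List (Fin 2)) (k : ℕ), a.length + k + 1 = m + 1 →
      S (a ++ 0 :: List.replicate k 1) := by
    intro a
    induction a with
    | nil =>
      intro k hk
      obtain rfl : k = m := by simpa using hk
      exact hT
    | cons x a ih =>
      intro k hk
      by_cases c : Cov m (((x :: a) ++ 0 :: List.replicate k 1) ++ [1])
      · rcases (cov_snoc1 m hm _).1 c with ⟨p, q, hpq, e⟩ | e | e
        · rcases q with _ | q
          · refine hX _ (by simp at hk ⊢; omega) c ?_
            rw [e]
            exact Or.inl ⟨0, p, by omega, by simp⟩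
          · rcases p with _ | _ | p
            · have : (0 : Fin 2) ∈ List.replicate (q + 1) (1 : Fin 2) := by
                have e' : (x :: a) ++ 0 :: List.replicate k 1 = List.replicate (q + 1) 1 := by
                  simpa using e
                rw [← e']; simp
              simp [List.mem_replicate] at this
            · rw [e]
              obtain rfl : m = q + 1 := by omega
              simpa using hT
            · refine h0 _ (by simp at hk ⊢; omega) c ?_
              rw [e]
              convert A (List.replicate (p + 1) 0 ++ List.replicate q 1) 0 (by simp; omega) using 1
              rw [List.replicate_succ' (n := q)]
              simp [List.replicate_succ]
        · exact hX _ (by simp at hk ⊢; omega) c (e ▸ xa)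
        · exact hX _ (by simp at hk ⊢; omega) c (e ▸ xb)
      · refine h1 _ (by simp at hk ⊢; omega) c ?_
        convert ih (k + 1) (by simp at hk; omega) using 1
        simp [List.replicate_succ']
  intro y hy
  rcases last_zero y with h | ⟨a, k, rfl⟩
  · rw [hy] at h
    refine hN y hy ?_ ?_
    · exact (cov_snoc0 m hm y).2 (Or.inl (Or.inl ⟨m + 1, 0, by omega, by simpa using h⟩))
    · exact (cov_snoc1 m hm y).2 (Or.inl ⟨0, m + 1, by omega, by simpa using h⟩)
  · exact B a k (by simp at hy; omega)

structure St (m : ℕ) (u : List (PSym 2)) (x : List (Fin 2)) (U : Set (List (Fin 2))) : Prop where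
  hx : x.length = m + 1
  hu : ∃ u', u = u' ++ x.map some
  hU : ∀ v ∈ U, v.length = m + 2
  hC : ∀ v, Cov m v → v ∈ U
  hM : ∀ v, v.length = m + 2 → ((∃ i, MatchAt u v i) ↔ v ∈ U)
  hq : ∀ v i j, v.length = m + 2 → MatchAt u v i → MatchAt u v j → i = j
  hb : ∀ y, ind (y ++ [0] ∈ U) + ind (y ++ [1] ∈ U) + ind (y = x) =
    ind (0 :: y ∈ U) + ind (1 :: y ∈ U) + ind (y = 0 :: List.replicate m 1)
  h4 : ∀ y, y ++ [1] ∈ U → Cov m (y ++ [1]) ∨ y ++ [0] ∈ U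
  hc : u.count none = 2
  hp : pre m <+: u

lemma st_base (m : ℕ) (hm : 2 ≤ m) :
    St m (pre m) (List.replicate m 0 ++ [1]) {v | Cov m v} where
  hx := by simp
  hu := ⟨none :: (List.replicate (m + 1) (some (0 : Fin 2)) ++
        List.replicate m (some (1 : Fin 2)) ++ [none, some (1 : Fin 2)]), by simp [pre]⟩
  hU := fun v hv => cov_length hv
  hC := fun v hv => hv
  hM := fun v hv => ⟨fun ⟨i, hi⟩ => cov_of_match m hm v hv i hi, fun h => match_of_cov m hm v h⟩
  hq := fun v i j hv hi hj => by
    have h1 := match_pre_lt m hm v hv i j hi hj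
    have h2 := match_pre_lt m hm v hv j i hj hi
    omega
  hb := fun y => cov_bal m hm y
  h4 := fun y h => Or.inl h
  hc := by simp [pre, List.count_replicate]
  hp := List.prefix_rfl

lemma match_snoc (u' : List (PSym 2)) (x v : List (Fin 2)) (a : Fin 2) (i : ℕ)
    (hv : v.length = x.length + 1) :
    MatchAt ((u' ++ x.map some) ++ [some a]) v i ↔
      MatchAt (u' ++ x.map some) v i ∨ (i = u'.length ∧ v = x ++ [a]) := by
  constructor
  · rintro ⟨h1, h2⟩
    simp only [List.length_append, List.length_map, List.length_singleton] at h1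
    by_cases hi : i = u'.length
    · right
      refine ⟨hi, List.ext_getElem (by simp [hv]) fun j hj1 hj2 => ?_⟩
      have := h2 j hj1
      rw [hi, List.append_assoc, List.getElem?_append_right (by omega),
        Nat.add_sub_cancel_left] at this
      have e : (x.map some ++ [some a] : List (PSym 2)) = (x ++ [a]).map some := by simp
      rw [e, List.getElem?_map, List.getElem?_eq_getElem hj1, List.getElem?_eq_getElem hj2] at this
      simp only [Option.map_some, Option.some.injEq] at this
      rcases this with h | h
      · simp at h
      · exact h.symm
    · left
      refine ⟨by simp; omega, fun j hj => ?_⟩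
      have := h2 j hj
      rwa [List.getElem?_append_left (by simp; omega)] at this
  · rintro (⟨h1, h2⟩ | ⟨rfl, rfl⟩)
    · refine ⟨by simp at h1 ⊢; omega, fun j hj => ?_⟩
      rw [List.getElem?_append_left (by omega)]
      exact h2 j hj
    · refine ⟨by simp, fun j hj => Or.inr ?_⟩
      rw [List.append_assoc, List.getElem?_append_right (by omega), Nat.add_sub_cancel_left]
      have e : (x.map some ++ [some a] : List (PSym 2)) = (x ++ [a]).map some := by simp
      rw [e, List.getElem?_map]

lemma ind_insert (U : Set (List (Fin 2))) (w z : List (Fin 2)) (h : w ∉ U) :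
    ind (z ∈ insert w U) = ind (z ∈ U) + ind (z = w) := by
  by_cases e : z = w
  · subst e; simp [ind, h]
  · have h1 : (z ∈ insert w U) = (z ∈ U) := by simp [e]
    have h2 : ind (z = w) = 0 := by simp [ind, e]
    rw [h1, h2, add_zero]

lemma ind_out (y x : List (Fin 2)) (a : Fin 2) :
    ind (y ++ [0] = x ++ [a]) + ind (y ++ [1] = x ++ [a]) = ind (y = x) := by
  unfold ind
  by_cases e : y = x
  · fin_cases a <;> simp [e]
  · simp [e]

lemma ind_in (y x : List (Fin 2)) (a : Fin 2) :
    ind (0 :: y = a :: x) + ind (1 :: y = a :: x) = ind (y = x) := by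
  unfold ind
  by_cases e : y = x
  · fin_cases a <;> simp [e]
  · simp [e]

lemma st_step (m : ℕ) (u : List (PSym 2)) (x : List (Fin 2)) (U : Set (List (Fin 2)))
    (h : St m u x U) (a : Fin 2) (ha : x ++ [a] ∉ U) (ha1 : a = 1 → x ++ [0] ∈ U) :
    St m (u ++ [some a]) (x ++ [a]).tail (insert (x ++ [a]) U) := by
  obtain ⟨hx, ⟨u', rfl⟩, hU, hC, hM, hq, hb, h4, hc, hp⟩ := h
  obtain ⟨c, x', rfl⟩ : ∃ c x', x = c :: x' := by
    rcases x with _ | ⟨c, x'⟩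
    · simp at hx
    · exact ⟨c, x', rfl⟩
  set x := c :: x' with hxd
  have key : ∀ v i, v.length = m + 2 → (MatchAt ((u' ++ x.map some) ++ [some a]) v i ↔
      MatchAt (u' ++ x.map some) v i ∨ (i = u'.length ∧ v = x ++ [a])) := fun v i hv =>
    match_snoc u' x v a i (by omega)
  have hl : (x ++ [a]).length = m + 2 := by simp [hx]
  have no : ∀ i, ¬ MatchAt (u' ++ x.map some) (x ++ [a]) i := fun i hi =>
    ha ((hM _ hl).1 ⟨i, hi⟩)
  refine ⟨by rw [List.length_tail, hl]; rfl, ⟨u' ++ [some c], by simp [hxd]⟩, ?_, fun v hv => Or.inr (hC v hv),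
    ?_, ?_, ?_, ?_, ?_, ?_⟩
  · rintro v (rfl | hv)
    · exact hl
    · exact hU v hv
  · intro v hv
    simp only [key v _ hv, Set.mem_insert_iff, ← hM v hv]
    constructor
    · rintro ⟨i, hi | hi⟩
      · exact Or.inr ⟨i, hi⟩
      · exact Or.inl hi.2
    · rintro (hi | ⟨i, hi⟩)
      · exact ⟨_, Or.inr ⟨rfl, hi⟩⟩
      · exact ⟨i, Or.inl hi⟩
  · intro v i j hv hi hj
    rw [key v _ hv] at hi hj
    rcases hi with hi | ⟨hi, rfl⟩
    · rcases hj with hj | ⟨hj, rfl⟩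
      · exact hq v i j hv hi hj
      · exact (no _ hi).elim
    · rcases hj with hj | ⟨hj, -⟩
      · exact (no _ hj).elim
      · omega
  · intro y
    simp only [ind_insert U _ _ ha]
    have e1 := ind_out y x a
    have e2 := ind_in y (x' ++ [a]) c
    have e3 := hb y
    have e4 : x ++ [a] = c :: (x' ++ [a]) := by simp [hxd]
    rw [e4] at e1 ⊢
    simp only [List.tail_cons]
    omega
  · intro y hy
    rcases hy with hy | hy
    · obtain ⟨rfl, h1⟩ := snoc_inj hy
      exact Or.inr (Or.inr (ha1 h1.symm))
    · rcases h4 y hy with h | h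
      · exact Or.inl h
      · exact Or.inr (Or.inr h)
  · rw [List.count_append, hc]; simp
  · exact hp.trans (List.prefix_append _ _)

lemma st_stuck (m : ℕ) : ∀ (k : ℕ) (u : List (PSym 2)) (x : List (Fin 2))
    (U : Set (List (Fin 2))), St m u x U →
    ({v : List (Fin 2) | v.length = m + 2} \ U).ncard = k →
    ∃ u x U, St m u x U ∧ x ++ [0] ∈ U ∧ x ++ [1] ∈ U := by
  intro k
  induction k using Nat.strong_induction_on with
  | _ k ih =>
    intro u x U h hk
    have step : ∀ a : Fin 2, x ++ [a] ∉ U → (a = 1 → x ++ [0] ∈ U) →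
        ∃ u x U, St m u x U ∧ x ++ [0] ∈ U ∧ x ++ [1] ∈ U := by
      intro a ha ha1
      refine ih _ ?_ _ _ _ (st_step m u x U h a ha ha1) rfl
      rw [← hk]
      apply Set.ncard_lt_ncard
      · refine ⟨fun v hv => ⟨hv.1, fun h => hv.2 (Or.inr h)⟩, fun hs => ?_⟩
        have := hs (show x ++ [a] ∈ _ from ⟨by simp [h.hx], ha⟩)
        exact this.2 (Or.inl rfl)
      · exact (List.finite_length_eq (Fin 2) (m + 2)).subset Set.sdiff_subset
    by_cases c0 : x ++ [0] ∈ U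
    · by_cases c1 : x ++ [1] ∈ U
      · exact ⟨u, x, U, h, c0, c1⟩
      · exact step 1 c1 (fun _ => c0)
    · exact step 0 c0 (fun h => absurd h (by decide))

lemma ind_le (p : Prop) : ind p ≤ 1 := by unfold ind; split_ifs <;> simp

lemma ind_true {p : Prop} (h : p) : ind p = 1 := by simp [ind, h]

lemma of_ind {p : Prop} (h : ind p = 1) : p := by
  by_contra hp
  simp [ind, hp] at h

lemma st_full (m : ℕ) (hm : 2 ≤ m) (u : List (PSym 2)) (x : List (Fin 2))
    (U : Set (List (Fin 2))) (h : St m u x U) (c0 : x ++ [0] ∈ U) (c1 : x ++ [1] ∈ U) :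
    ∀ v, v.length = m + 2 → v ∈ U := by
  have hb := h.hb
  have hx := hb x
  rw [ind_true c0, ind_true c1, ind_true rfl] at hx
  have b1 := ind_le (0 :: x ∈ U)
  have b2 := ind_le (1 :: x ∈ U)
  have b3 := ind_le (x = 0 :: List.replicate m 1)
  have ht : x = 0 :: List.replicate m 1 := of_ind (by omega)
  have full : ∀ y, y ++ [0] ∈ U → y ++ [1] ∈ U → (0 :: y ∈ U ∧ 1 :: y ∈ U) := by
    intro y y0 y1
    have e := hb y
    rw [ind_true y0, ind_true y1, ht] at e
    have b1 := ind_le (0 :: y ∈ U)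
    have b2 := ind_le (1 :: y ∈ U)
    exact ⟨of_ind (by omega), of_ind (by omega)⟩
  have pred : ∀ y (a : Fin 2), y.length = m + 1 →
      (0 :: (y ++ [a]).tail ∈ U ∧ 1 :: (y ++ [a]).tail ∈ U) → y ++ [a] ∈ U := by
    intro y a hy hs
    rcases y with _ | ⟨c, y⟩
    · simp at hy
    · fin_cases c
      · exact hs.1
      · exact hs.2
  have all := reach m hm (fun y => 0 :: y ∈ U ∧ 1 :: y ∈ U)
    (ht ▸ full x c0 c1)
    (fun y _ y0 y1 => full y (h.hC _ y0) (h.hC _ y1))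
    (fun y hy y1 hs => by
      have m1 := pred y 1 hy hs
      rcases h.h4 y m1 with q | q
      · exact absurd q y1
      · exact full y q m1)
    (fun y hy y1 hs => full y (pred y 0 hy hs) (h.hC _ y1))
  intro v hv
  rcases v with _ | ⟨c, y⟩
  · simp at hv
  · have := all y (by simpa using hv)
    fin_cases c
    · exact this.1
    · exact this.2

/-- For `A = {0,1}` and any `n ≥ 4`, there exists a linear upword for `A^n`
with exactly two `◊`s that begins with `◊ 0^{n-1} 1^{n-2} ◊ 1 0^{n-2} 1`. -/
theorem upword_two_diamonds_exists (n : ℕ) (hn : 4 ≤ n) :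
    ∃ u : List (PSym 2), IsLinearUpword 2 n u ∧ u.count (none : PSym 2) = 2 ∧
      (none :: (List.replicate (n - 1) (some (0 : Fin 2)) ++
        List.replicate (n - 2) (some (1 : Fin 2)) ++ [none, some (1 : Fin 2)] ++
        List.replicate (n - 2) (some (0 : Fin 2)) ++ [some (1 : Fin 2)])) <+: u := by
  obtain ⟨m, rfl⟩ : ∃ m, n = m + 2 := ⟨n - 2, by omega⟩
  have hm : 2 ≤ m := by omega
  obtain ⟨u, x, U, h, c0, c1⟩ := st_stuck m _ _ _ _ (st_base m hm) rfl
  refine ⟨u, fun v hv => ?_, h.hc, h.hp⟩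
  obtain ⟨i, hi⟩ := (h.hM v hv).2 (st_full m hm u x U h c0 c1 v hv)
  exact ⟨i, hi, fun j hj => h.hq v j i hv hj hi⟩
end
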